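/- arXiv:1410.8515 — 3 statements merged into one kernel-verified Lean document; each statement's English description precedes it below -/
import Mathlib

section
/- There exists a constant C > 0 such that for every natural number n ≥ 2, with l₀ = ⌈3·√(n·log n)⌉, one has ∑_{l = l₀}^{∞} exp(−l(l−1)/(4n)) ≤ C · n^{−7/4}. -/
/-- A geometric series with ratio `e^{-x}` has sum at most `1 + 1/x`. -/
lemma inv_one_sub_exp_neg_le {x : ℝ} (hx : 0 < x) :
    (1 - Real.exp (-x))⁻¹ ≤ 1 + 1 / x := by
  have h1 : Real.exp (-x) ≤ 1 / (1 + x) := by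
    rw [Real.exp_neg, ← one_div]
    exact one_div_le_one_div_of_le (by positivity) (by linarith [Real.add_one_le_exp x])
  have h2 : x / (1 + x) ≤ 1 - Real.exp (-x) := by
    have : x / (1 + x) = 1 - 1 / (1 + x) := by field_simp; ring
    linarith
  calc (1 - Real.exp (-x))⁻¹ ≤ (x / (1 + x))⁻¹ := inv_anti₀ (by positivity) h2
    _ = 1 + 1 / x := by field_simp; ring

/-- Terms of a discrete Gaussian tail starting at `m ≥ a` are dominated by a geometric sequence. -/
lemma exp_neg_mul_pred_div_le {n a s m j : ℝ} (hn : 0 < n) (hs : 0 < s) (hsn : s ^ 2 = n)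
    (ha : 1 ≤ a) (has : 2 * s ≤ a) (han : a ≤ 3 * n) (ham : a ≤ m) (hj : 0 ≤ j) :
    Real.exp (-((m + j) * (m + j - 1)) / (4 * n)) ≤
      Real.exp (3 / 4 - a ^ 2 / (4 * n)) * Real.exp (j * -(1 / (2 * s))) := by
  rw [← Real.exp_add, Real.exp_le_exp]
  have h : 3 / 4 - a ^ 2 / (4 * n) + j * -(1 / (2 * s)) =
      (3 * n - a ^ 2 - 2 * s * j) / (4 * n) := by
    subst hsn
    field_simp
    ring
  rw [h]
  gcongr
  have h1 : a * (a - 1) ≤ m * (m - 1) := by nlinarith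
  have h2 : 2 * s * j ≤ (2 * m - 1) * j := by gcongr; linarith
  nlinarith [sq_nonneg j]

/-- With `l₀ = ⌈3√(n log n)⌉`, the tail sum `∑_{l ≥ l₀} e^{-l(l-1)/(4n)}`
is `O(n^{-7/4})`. -/
theorem stmt_6 : ∃ C : ℝ, 0 < C ∧ ∀ n : ℕ, 2 ≤ n →
    ∑' l : ℕ,
      Real.exp (-(((⌈3 * Real.sqrt (n * Real.log n)⌉₊ + l : ℕ) : ℝ) *
          (((⌈3 * Real.sqrt (n * Real.log n)⌉₊ + l : ℕ) : ℝ) - 1)) / (4 * n)) ≤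
      C * (n : ℝ) ^ (-(7 / 4) : ℝ) := by
  refine ⟨3 * Real.exp (3 / 4), by positivity, fun n hn => ?_⟩
  have hn2 : (2 : ℝ) ≤ n := by exact_mod_cast hn
  have hn0 : (0 : ℝ) < n := by linarith
  have hlog : 4 / 9 ≤ Real.log n := by
    have := Real.log_le_log (by norm_num) hn2
    linarith [Real.log_two_gt_d9]
  have hlogn : Real.log n ≤ n := by linarith [Real.log_le_sub_one_of_pos hn0]
  set s := Real.sqrt n with hs
  have hs1 : 1 ≤ s := Real.one_le_sqrt.2 (by linarith)
  have hsn : s ^ 2 = n := Real.sq_sqrt hn0.le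
  set a := 3 * Real.sqrt (n * Real.log n) with ha
  have ha2 : a ^ 2 = 9 * (n * Real.log n) := by
    rw [ha, mul_pow, Real.sq_sqrt (by positivity)]
    norm_num
  have ha0 : 0 ≤ a := by positivity
  have has : 2 * s ≤ a := abs_le_of_sq_le_sq' (by nlinarith) ha0 |>.2
  have han : a ≤ 3 * n := abs_le_of_sq_le_sq' (by nlinarith) (by positivity) |>.2
  set r := Real.exp (-(1 / (2 * s))) with hr
  have hr1 : r < 1 := Real.exp_lt_one_iff.2 (neg_lt_zero.2 (by positivity))
  have hbound (l : ℕ) : Real.exp (-(((⌈a⌉₊ + l : ℕ) : ℝ) * (((⌈a⌉₊ + l : ℕ) : ℝ) - 1)) / (4 * n)) ≤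
      Real.exp (3 / 4 - a ^ 2 / (4 * n)) * r ^ l := by
    rw [hr, ← Real.exp_nat_mul]
    push_cast
    exact exp_neg_mul_pred_div_le hn0 (by linarith) hsn (by linarith) has han
      (Nat.le_ceil a) l.cast_nonneg
  have hsum := (summable_geometric_of_lt_one (Real.exp_pos _).le hr1).mul_left
    (Real.exp (3 / 4 - a ^ 2 / (4 * n)))
  have hinv : (1 - r)⁻¹ ≤ 3 * s := by
    refine (inv_one_sub_exp_neg_le (by positivity)).trans ?_
    rw [one_div_one_div]
    linarith
  have hexp : Real.exp (3 / 4 - a ^ 2 / (4 * n)) =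
      Real.exp (3 / 4) * (n : ℝ) ^ (-(9 / 4) : ℝ) := by
    rw [Real.rpow_def_of_pos hn0, ← Real.exp_add, ha2]
    congr 1
    field_simp
    ring
  calc _ ≤ ∑' l : ℕ, Real.exp (3 / 4 - a ^ 2 / (4 * n)) * r ^ l :=
        (hsum.of_nonneg_of_le (fun _ => (Real.exp_pos _).le) hbound).tsum_le_tsum hbound hsum
    _ = Real.exp (3 / 4 - a ^ 2 / (4 * n)) * (1 - r)⁻¹ := by
        rw [tsum_mul_left, tsum_geometric_of_lt_one (Real.exp_pos _).le hr1]
    _ ≤ Real.exp (3 / 4 - a ^ 2 / (4 * n)) * (3 * s) := by gcongr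
    _ = 3 * Real.exp (3 / 4) * ((n : ℝ) ^ (-(9 / 4) : ℝ) * (n : ℝ) ^ (1 / 2 : ℝ)) := by
        rw [hexp, hs, Real.sqrt_eq_rpow]
        ring
    _ = 3 * Real.exp (3 / 4) * (n : ℝ) ^ (-(7 / 4) : ℝ) := by
        rw [← Real.rpow_add hn0]
        norm_num
end

section
/- Let n, k be natural numbers with 1 ≤ k ≤ n, and let s₀₁ = ⌈−2k + √(4kn − 2n + 1/4) + 1/2⌉ (the ceiling of the real number −2k + √(4kn − 2n + 1/4) + 1/2). Then |s₀₁ + 2k − 2√(kn)| ≤ 2√n. -/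
/-- The mode `s₀₁ = ⌈-2k + √(4kn - 2n + 1/4) + 1/2⌉` satisfies
`|s₀₁ + 2k - 2√(kn)| ≤ 2√n` (Equation (9)). -/
theorem stmt_7 (n k : ℕ) (hk : 1 ≤ k) (hkn : k ≤ n) :
    |((⌈-2 * (k : ℝ) + Real.sqrt (4 * k * n - 2 * n + 1 / 4) + 1 / 2⌉ : ℤ) : ℝ) +
        2 * k - 2 * Real.sqrt (k * n)| ≤ 2 * Real.sqrt n := by
  have hk' : (1 : ℝ) ≤ k := by exact_mod_cast hk
  have hn' : (1 : ℝ) ≤ n := by exact_mod_cast hk.trans hkn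
  have hle := Int.le_ceil (-2 * (k : ℝ) + Real.sqrt (4 * k * n - 2 * n + 1 / 4) + 1 / 2)
  have hlt := Int.ceil_lt_add_one (-2 * (k : ℝ) + Real.sqrt (4 * k * n - 2 * n + 1 / 4) + 1 / 2)
  have hmul : Real.sqrt (k * n) = Real.sqrt k * Real.sqrt n := Real.sqrt_mul (by positivity) _
  have ha : 1 ≤ Real.sqrt k := Real.one_le_sqrt.mpr hk'
  have hb : 1 ≤ Real.sqrt n := Real.one_le_sqrt.mpr hn'
  have ha2 : Real.sqrt k ^ 2 = k := Real.sq_sqrt (by positivity)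
  have hb2 : Real.sqrt n ^ 2 = n := Real.sq_sqrt (by positivity)
  have hupper : Real.sqrt (4 * k * n - 2 * n + 1 / 4) ≤ 2 * (Real.sqrt k * Real.sqrt n) := by
    refine Real.sqrt_le_iff.mpr ⟨by positivity, ?_⟩
    rw [mul_pow, mul_pow, ha2, hb2]
    linarith
  have hlower : 2 * (Real.sqrt k * Real.sqrt n) - 2 * Real.sqrt n ≤
      Real.sqrt (4 * k * n - 2 * n + 1 / 4) := by
    refine Real.le_sqrt_of_sq_le ?_
    have hsq : (2 * (Real.sqrt k * Real.sqrt n) - 2 * Real.sqrt n) ^ 2 =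
        4 * n * (k - 2 * Real.sqrt k + 1) := by
      linear_combination 4 * n * ha2 + 4 * (Real.sqrt k - 1) ^ 2 * hb2
    rw [hsq]
    nlinarith
  rw [hmul, abs_le]
  constructor <;> linarith
end

section
/- Let β be a real number with 1/2 < β ≤ 1. Then for every ε > 0 there exists N such that for all natural numbers n ≥ N and all real k with n^β/log n ≤ k ≤ n − n^β/log n, one has 0 < 2√(kn) − 2k and √(n·log n) / (2√(kn) − 2k) ≤ ε. -/
/-- The concave function `k ↦ 2√(kn) - 2k` is at least `M / 2` on `[M, n - M]`. -/
lemma half_le_two_mul_sqrt_mul_sub {n k M : ℝ} (hM : 0 < M) (h1 : M ≤ k) (h2 : k ≤ n - M) :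
    M / 2 ≤ 2 * Real.sqrt (k * n) - 2 * k := by
  have hk : 0 < k := hM.trans_le h1
  have hn : 0 < n := by linarith
  have hx0 : 0 < k / n := by positivity
  have hx1 : k / n ≤ 1 := (div_le_one hn).2 (by linarith)
  have hkx : k = k / n * n := by field_simp
  set x := k / n
  have hsqrt : n * (x * (3 - x) / 2) ≤ Real.sqrt (k * n) := by
    apply Real.le_sqrt_of_sq_le
    have hpoly : x * (3 - x) ^ 2 ≤ 4 := by
      nlinarith [mul_nonneg (sq_nonneg (1 - x)) (by linarith : 0 ≤ 4 - x)]
    calc (n * (x * (3 - x) / 2)) ^ 2 = n ^ 2 * x * (x * (3 - x) ^ 2) / 4 := by ring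
      _ ≤ n ^ 2 * x * 4 / 4 := by gcongr
      _ = k * n := by rw [hkx]; ring
  have hprod : M / 2 ≤ k * (1 - x) := by
    rcases le_total x (1 / 2) with h | h
    · nlinarith
    · have : M ≤ n * (1 - x) := by nlinarith
      nlinarith
  nlinarith

/-- For `β > 1/2`, `√(n log n)` is eventually at most any fixed multiple of `n^β / log n`. -/
lemma eventually_sqrt_mul_log_le {β c : ℝ} (hβ : 1 / 2 < β) (hc : 0 < c) :
    ∀ᶠ x : ℝ in Filter.atTop,
      Real.sqrt (x * Real.log x) ≤ c * (x ^ β / Real.log x) := by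
  have hlog := (isLittleO_log_rpow_atTop (r := (β - 1 / 2) / 2) (by linarith)).bound
    (Real.sqrt_pos.2 hc)
  filter_upwards [hlog, Filter.eventually_gt_atTop 0,
    Real.tendsto_log_atTop.eventually_ge_atTop 1] with x hx hx0 hl
  have hl0 : 0 < Real.log x := by linarith
  rw [Real.norm_of_nonneg hl0.le, Real.norm_of_nonneg (by positivity)] at hx
  rw [← mul_div_assoc, le_div_iff₀ hl0, Real.sqrt_mul hx0.le]
  have hsl : Real.sqrt (Real.log x) ≤ Real.log x :=
    Real.sqrt_le_iff.2 ⟨hl0.le, by nlinarith⟩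
  calc Real.sqrt x * Real.sqrt (Real.log x) * Real.log x
      ≤ Real.sqrt x * Real.log x * Real.log x := by gcongr
    _ ≤ Real.sqrt x * (Real.sqrt c * x ^ ((β - 1 / 2) / 2))
          * (Real.sqrt c * x ^ ((β - 1 / 2) / 2)) := by gcongr
    _ = Real.sqrt c ^ 2
          * (x ^ (1 / 2 : ℝ) * x ^ ((β - 1 / 2) / 2) * x ^ ((β - 1 / 2) / 2)) := by
        rw [Real.sqrt_eq_rpow x]; ring
    _ = c * x ^ β := by
        rw [Real.sq_sqrt hc.le, ← Real.rpow_add hx0, ← Real.rpow_add hx0]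
        congr 2
        ring

/-- Claim 7 (with `β > 1/2`): uniformly over middle indices
`M ≤ k ≤ n - M` (with `M = n^β / log n`), the mean `2√(kn) - 2k` is positive
and `√(n log n) / (2√(kn) - 2k)` tends to zero. -/
theorem stmt_11 (β : ℝ) (hβ0 : 1 / 2 < β) (hβ1 : β ≤ 1) :
    ∀ ε > 0, ∃ N : ℕ, ∀ n : ℕ, N ≤ n →
      ∀ k : ℝ, (n : ℝ) ^ β / Real.log n ≤ k → k ≤ (n : ℝ) - (n : ℝ) ^ β / Real.log n →
        0 < 2 * Real.sqrt (k * n) - 2 * k ∧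
        Real.sqrt ((n : ℝ) * Real.log n) / (2 * Real.sqrt (k * n) - 2 * k) ≤ ε := by
  intro ε hε
  have hev := (eventually_sqrt_mul_log_le hβ0 (half_pos hε)).and
    (Filter.eventually_gt_atTop (1 : ℝ))
  obtain ⟨N, hN⟩ := Filter.eventually_atTop.1 (tendsto_natCast_atTop_atTop.eventually hev)
  refine ⟨N, fun n hn k h1 h2 => ?_⟩
  obtain ⟨hle, hn1⟩ := hN n hn
  have hM : 0 < (n : ℝ) ^ β / Real.log n :=
    div_pos (Real.rpow_pos_of_pos (by linarith) β) (Real.log_pos hn1)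
  have hD := half_le_two_mul_sqrt_mul_sub hM h1 h2
  have hpos : 0 < 2 * Real.sqrt (k * n) - 2 * k := by linarith
  refine ⟨hpos, (div_le_iff₀ hpos).2 ?_⟩
  nlinarith
end
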